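/- arXiv:1610.03472 — 4 statements merged into one kernel-verified Lean document; each statement's English description precedes it below -/
import Mathlib

section
/- Let p be a probability mass function (PMF) on ℝⁿ, O : ℝⁿ → Set ℝⁿ, and α ∈ (0,∞]. Define the occupancy function φ_p(y) = ∑'_{z} p(z) · 1_{O(z)}(y). Then the α-superlevel set of φ_p admits the decomposition S_α := { y | φ_p(y) ≥ α } = ⋃_{D ∈ 𝒟} ⋂_{z ∈ D} O(z), where 𝒟 is the collection of sets D ⊆ support(p) with ∑'_{z ∈ D} p(z) ≥ α. Moreover, if O(z) is a convex set for every z, then each ⋂_{z ∈ D} O(z) is convex, so S_α is a union of convex sets. -/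
open scoped ENNReal

/-- Proposition 1 with decomposition (9): the `α`-superlevel set of the occupancy
function `φ_p(y) = ∑' z, p z * 1_{O z}(y)` equals the union, over families
`D ⊆ support p` of centers with total mass at least `α`, of the intersections
`⋂ z ∈ D, O z`; and when every rigid body `O z` is convex, each such
intersection is convex, so the superlevel set is a union of convex sets. -/
theorem occupancy_superlevel_decomposition (n : ℕ) (p : PMF (Fin n → ℝ))
    (O : (Fin n → ℝ) → Set (Fin n → ℝ)) (α : ℝ≥0∞) (hα : 0 < α) :
    ({ y : Fin n → ℝ |
        α ≤ ∑' z : Fin n → ℝ, p z * (O z).indicator (fun _ => (1 : ℝ≥0∞)) y }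
      = ⋃ D ∈ { D : Set (Fin n → ℝ) | D ⊆ p.support ∧ α ≤ ∑' z : D, p z.1 },
          ⋂ z ∈ D, O z)
    ∧ ((∀ z : Fin n → ℝ, Convex ℝ (O z)) →
        ∀ D ∈ { D : Set (Fin n → ℝ) | D ⊆ p.support ∧ α ≤ ∑' z : D, p z.1 },
          Convex ℝ (⋂ z ∈ D, O z)) := by
  refine ⟨?_, fun h D _ => convex_iInter₂ fun z _ => h z⟩
  ext y
  simp only [Set.mem_setOf_eq, Set.mem_iUnion, Set.mem_iInter, exists_prop]
  constructor
  · intro h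
    refine ⟨{z | z ∈ p.support ∧ y ∈ O z}, ⟨fun z hz => hz.1, ?_⟩, fun z hz => hz.2⟩
    rw [tsum_subtype _ (fun z => p z)]
    refine h.trans (ENNReal.tsum_le_tsum fun z => ?_)
    by_cases hy : y ∈ O z
    · by_cases hp : p z = 0
      · simp [hp]
      · simp [Set.indicator, hy, hp, PMF.mem_support_iff]
    · simp [hy]
  · rintro ⟨D, ⟨_, hD⟩, hy⟩
    rw [tsum_subtype D (fun z => p z)] at hD
    refine hD.trans (ENNReal.tsum_le_tsum fun z => ?_)
    by_cases hz : z ∈ D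
    · simp [hz, hy z hz]
    · simp [hz]
end

section
/- Let P be a probability mass function (PMF) on the configuration space Fin N → ℝⁿ (the joint law of N obstacle centers), O : ℝⁿ → Set ℝⁿ, and α ∈ (0,∞]. Define the joint occupancy function Φ_P(y) = ∑'_{Z} P(Z) · 1[∃ i, y ∈ O(Z i)]. Then { y | Φ_P(y) ≥ α } = ⋃_{D ∈ 𝒟} ⋂_{Z ∈ D} ⋃_{i} O(Z i), where 𝒟 is the collection of sets D ⊆ support(P) with ∑'_{Z ∈ D} P(Z) ≥ α. -/
open scoped ENNReal

/-- Equation (17): the `α`-superlevel set of the joint occupancy function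
`Φ_P(y) = ∑' Z, P Z * 1_{⋃ i, O (Z i)}(y)` of `N` rigid-body obstacles with joint
center law `P` equals the union, over families `D ⊆ support P` of configurations
with total mass at least `α`, of the intersections `⋂ Z ∈ D, ⋃ i, O (Z i)`. -/
theorem joint_occupancy_superlevel_decomposition (n N : ℕ)
    (P : PMF (Fin N → (Fin n → ℝ)))
    (O : (Fin n → ℝ) → Set (Fin n → ℝ)) (α : ℝ≥0∞) (hα : 0 < α) :
    { y : Fin n → ℝ |
        α ≤ ∑' Z : Fin N → (Fin n → ℝ),
              P Z * (⋃ i : Fin N, O (Z i)).indicator (fun _ => (1 : ℝ≥0∞)) y }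
      = ⋃ D ∈ { D : Set (Fin N → (Fin n → ℝ)) |
                  D ⊆ P.support ∧ α ≤ ∑' Z : D, P Z.1 },
          ⋂ Z ∈ D, ⋃ i : Fin N, O (Z i) := by
  ext y
  simp only [Set.mem_setOf_eq, Set.mem_iUnion₂, Set.mem_iInter₂, exists_prop]
  constructor
  · intro h
    refine ⟨{Z | Z ∈ P.support ∧ y ∈ ⋃ i : Fin N, O (Z i)}, ⟨fun Z hZ => hZ.1, ?_⟩,
      fun Z hZ => hZ.2⟩
    rw [tsum_subtype _ (fun Z => P Z)]
    refine h.trans (ENNReal.tsum_le_tsum fun Z => ?_)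
    by_cases hP : P Z = 0
    · simp [hP]
    · by_cases hy : y ∈ ⋃ i : Fin N, O (Z i)
      · rw [Set.indicator_of_mem hy, Set.indicator_of_mem, mul_one]
        exact ⟨(P.mem_support_iff Z).2 hP, hy⟩
      · rw [Set.indicator_of_notMem hy, mul_zero]
        exact zero_le
  · rintro ⟨D, ⟨-, hD⟩, hy⟩
    rw [tsum_subtype D (fun Z => P Z)] at hD
    refine hD.trans (ENNReal.tsum_le_tsum fun Z => ?_)
    by_cases hZ : Z ∈ D
    · rw [Set.indicator_of_mem hZ, Set.indicator_of_mem (hy Z hZ), mul_one]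
    · rw [Set.indicator_of_notMem hZ]
      exact zero_le
end

section
/- Let P be a probability mass function (PMF) on the configuration space Fin N → ℝⁿ with N ≥ 1, O : ℝⁿ → Set ℝⁿ, and α ∈ (0,∞] (extended nonnegative real). Define the joint occupancy function Φ_P(y) = ∑'_{Z} P(Z) · 1[∃ i, y ∈ O(Z i)] and, for each i, the marginal occupancy function φ_i(y) = ∑'_{z} (P.map (fun Z => Z i))(z) · 1_{O(z)}(y). Then ⋂_{i ∈ Fin N} { y | φ_i(y) < α/N } ⊆ { y | Φ_P(y) < α }, i.e. the under-approximated safe set is contained in the true safe set: SafeSet̲[t; α] ⊆ SafeSet[t; α]. -/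
open scoped ENNReal

/-- The containment (22): the under-approximated safe set, obtained by requiring
each marginal occupancy function `φ_i` to be below `α / N`, is contained in the
true safe set where the joint occupancy function `Φ_P` is below `α`. -/
theorem underapprox_safe_set_subset (n N : ℕ) (hN : 1 ≤ N)
    (P : PMF (Fin N → (Fin n → ℝ)))
    (O : (Fin n → ℝ) → Set (Fin n → ℝ)) (α : ℝ≥0∞) (hα : 0 < α) :
    (⋂ i : Fin N,
        { y : Fin n → ℝ |
            (∑' z : Fin n → ℝ,
              (P.map (fun Z => Z i)) z * (O z).indicator (fun _ => (1 : ℝ≥0∞)) y)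
              < α / N })
      ⊆ { y : Fin n → ℝ |
            (∑' Z : Fin N → (Fin n → ℝ),
              P Z * (⋃ i : Fin N, O (Z i)).indicator (fun _ => (1 : ℝ≥0∞)) y)
              < α } := by
  intro y hy
  simp only [Set.mem_iInter, Set.mem_setOf_eq] at hy ⊢
  have h1 : ∀ (β : Type) (Q : PMF β) (S : β → Set (Fin n → ℝ)),
      (∑' z, Q z * (S z).indicator (fun _ => (1 : ℝ≥0∞)) y)
        = Q.toOuterMeasure {z | y ∈ S z} := by
    intro β Q S
    rw [PMF.toOuterMeasure_apply]
    refine tsum_congr fun z => ?_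
    by_cases h : y ∈ S z <;> simp [Set.indicator, h]
  simp only [h1 _ _ O, PMF.toOuterMeasure_map_apply] at hy
  rw [h1 _ P (fun Z => ⋃ i : Fin N, O (Z i))]
  have hN0 : (N : ℝ≥0∞) ≠ 0 := by
    simp only [ne_eq, Nat.cast_eq_zero]
    omega
  haveI : Nonempty (Fin N) := ⟨⟨0, hN⟩⟩
  have h2 : {Z : Fin N → (Fin n → ℝ) | y ∈ ⋃ i : Fin N, O (Z i)}
      = ⋃ i : Fin N, (fun Z : Fin N → (Fin n → ℝ) => Z i) ⁻¹' {z | y ∈ O z} := by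
    ext Z
    simp
  rw [h2]
  calc P.toOuterMeasure (⋃ i : Fin N, (fun Z : Fin N → (Fin n → ℝ) => Z i) ⁻¹' {z | y ∈ O z})
      ≤ ∑ i : Fin N, P.toOuterMeasure
          ((fun Z : Fin N → (Fin n → ℝ) => Z i) ⁻¹' {z | y ∈ O z}) :=
        MeasureTheory.measure_iUnion_fintype_le _ _
    _ < ∑ _i : Fin N, α / N :=
        ENNReal.sum_lt_sum_of_nonempty Finset.univ_nonempty fun i _ => hy i
    _ = α := by
        rw [Finset.sum_const, Finset.card_univ, Fintype.card_fin, nsmul_eq_mul]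
        exact ENNReal.mul_div_cancel hN0 (ENNReal.natCast_ne_top N)
end

section
/- Let A : ℝⁿ →ₗ[ℝ] ℝⁿ be a linear map, let p₀ and q be probability mass functions (PMFs) on ℝⁿ, and define p_{t+1} = step(p_t) where step(p) = p.bind (fun x => q.map (fun v => A x + v)) is the law of the linear system x[t+1] = A x[t] + v[t] with i.i.d. v[t] ~ q. Then for every t ∈ ℕ, support(p_t) = (A^t) '' support(p₀) + ∑_{k=0}^{t-1} (A^k) '' support(q), where the sums on the right are Minkowski sums of subsets of ℝⁿ and A^k denotes the k-fold composition of A. -/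
open Pointwise

/-- Closed form for the forward stochastic reach set of the linear system
`x[t+1] = A x[t] + v[t]` with `x[0] ~ p₀` and i.i.d. `v[t] ~ q`:
`support (p t) = A^t '' support p₀ + ∑_{k=0}^{t-1} A^k '' support q`
(Minkowski sums). -/
theorem fsr_support_linear (n : ℕ)
    (A : (Fin n → ℝ) →ₗ[ℝ] (Fin n → ℝ))
    (p₀ q : PMF (Fin n → ℝ))
    (p : ℕ → PMF (Fin n → ℝ))
    (hp0 : p 0 = p₀)
    (hp : ∀ t : ℕ, p (t + 1) = (p t).bind (fun x => q.map (fun v => A x + v))) :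
    ∀ t : ℕ, (p t).support
      = (A ^ t) '' p₀.support + ∑ k ∈ Finset.range t, (A ^ k) '' q.support := by
  have hstep : ∀ t, (p (t + 1)).support = A '' (p t).support + q.support := by
    intro t
    rw [hp t]
    ext y
    simp only [PMF.mem_support_bind_iff, PMF.mem_support_map_iff, Set.mem_add, Set.mem_image]
    constructor
    · rintro ⟨x, hx, v, hv, rfl⟩
      exact ⟨A x, ⟨x, hx, rfl⟩, v, hv, rfl⟩
    · rintro ⟨_, ⟨x, hx, rfl⟩, v, hv, rfl⟩
      exact ⟨x, hx, v, hv, rfl⟩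
  have hpow : ∀ (k : ℕ) (S : Set (Fin n → ℝ)), A '' ((A ^ k) '' S) = (A ^ (k + 1)) '' S := by
    intro k S
    rw [← Set.image_comp, pow_succ']
    rfl
  have hsum : ∀ t : ℕ, A '' (∑ k ∈ Finset.range t, (A ^ k) '' q.support)
      = ∑ k ∈ Finset.range t, (A ^ (k + 1)) '' q.support := by
    intro t
    induction t with
    | zero => simp [Set.singleton_zero]
    | succ t ih => rw [Finset.sum_range_succ, Finset.sum_range_succ, Set.image_add, ih, hpow]
  intro t
  induction t with
  | zero => simp [hp0]
  | succ t ih =>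
    have h0 : (⇑(A ^ (0 : ℕ) : Module.End ℝ (Fin n → ℝ))) '' q.support = q.support := by simp
    rw [hstep, ih, Set.image_add, hpow, hsum, Finset.sum_range_succ', h0, add_assoc]
end
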